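/- Every nondegenerate quadratic space (U,Q) over the p-adic field ℚ_p (p odd) decomposes as an orthogonal direct sum of d hyperbolic planes and an anisotropic subspace U_an, and the dimension of U_an is at most 4. -/

import Mathlib

/-- The hyperbolic plane over a field `K`: the quadratic form `(a₁, a₂) ↦ a₁ * a₂` on `K × K`. -/
noncomputable def hyperbolicPlane (K : Type*) [Field K] : QuadraticForm K (K × K) :=
  LinearMap.BilinMap.toQuadraticMap
    ((LinearMap.mul K K).compl₁₂ (LinearMap.fst K K K) (LinearMap.snd K K K))

open Polynomial in
theorem aux_hensel (p : ℕ) [Fact p.Prime] (hp : p ≠ 2) (u c t : ℤ_[p]) (hu : ‖u‖ = 1)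
    (ht : PadicInt.toZMod t ≠ 0) (h : PadicInt.toZMod (u * t ^ 2 + c) = 0) :
    ∃ x : ℤ_[p], u * x ^ 2 + c = 0 := by
  have key : ∀ z : ℤ_[p], PadicInt.toZMod z = 0 ↔ ‖z‖ < 1 := by
    intro z
    rw [← RingHom.mem_ker, PadicInt.ker_toZMod, IsLocalRing.mem_maximalIdeal, PadicInt.mem_nonunits]
  have key1 : ∀ z : ℤ_[p], PadicInt.toZMod z ≠ 0 → ‖z‖ = 1 := by
    intro z hz
    rw [Ne, key, not_lt] at hz
    exact le_antisymm (PadicInt.norm_le_one z) hz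
  have h2 : ‖(2 : ℤ_[p])‖ = 1 := by
    apply key1
    rw [map_ofNat]
    have : Fact (2 < p) := ⟨lt_of_le_of_ne (Fact.out : p.Prime).two_le hp.symm⟩
    intro h2
    have := (ZMod.natCast_eq_zero_iff 2 p).1 (by exact_mod_cast h2)
    exact absurd (Nat.le_of_dvd (by norm_num) this) (by have := this; have := ‹Fact (2 < p)›.out; omega)
  obtain ⟨z, hz, -⟩ := hensels_lemma (p := p) (R := ℤ_[p]) (F := C u * X ^ 2 + C c) (a := t) (by
    simp only [map_add, map_mul, map_pow, aeval_C, aeval_X, derivative_mul, derivative_C, derivative_X_pow]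
    have : ‖u * t ^ 2 + c‖ < 1 := (key _).1 h
    simp
    rw [hu, h2, key1 t ht]
    simpa using this)
  exact ⟨z, by simpa using hz⟩

open Polynomial in
theorem aux_units (p : ℕ) [Fact p.Prime] (hp : p ≠ 2) (u v w : ℤ_[p]) (hu : ‖u‖ = 1)
    (hv : ‖v‖ = 1) (hw : ‖w‖ = 1) :
    ∃ x y : ℤ_[p], u * x ^ 2 + v * y ^ 2 + w = 0 := by
  have key : ∀ z : ℤ_[p], ‖z‖ = 1 → PadicInt.toZMod z ≠ 0 := by
    intro z hz
    rw [Ne, ← RingHom.mem_ker, PadicInt.ker_toZMod, IsLocalRing.mem_maximalIdeal, PadicInt.mem_nonunits]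
    simp [hz]
  have hu' := key u hu
  have hv' := key v hv
  have hw' := key w hw
  obtain ⟨a, b, hab⟩ := FiniteField.exists_root_sum_quadratic (R := ZMod p)
    (f := C (PadicInt.toZMod u) * X ^ 2 + C 0 * X + C 0)
    (g := C (PadicInt.toZMod v) * X ^ 2 + C 0 * X + C (PadicInt.toZMod w))
    (degree_quadratic hu') (degree_quadratic hv')
    (by rw [ZMod.card]; exact ((Fact.out : p.Prime).eq_two_or_odd).resolve_left hp)
  simp at hab
  obtain ⟨a, rfl⟩ := ZMod.ringHom_surjective (PadicInt.toZMod (p := p)) a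
  obtain ⟨b, rfl⟩ := ZMod.ringHom_surjective (PadicInt.toZMod (p := p)) b
  by_cases ha : PadicInt.toZMod a = 0
  · have hb : PadicInt.toZMod b ≠ 0 := by
      intro hb
      simp [ha, hb] at hab
      exact hw' hab
    obtain ⟨x, hx⟩ := aux_hensel p hp v (u * a ^ 2 + w) b hv hb (by
      simp only [map_add, map_mul, map_pow]; linear_combination hab)
    exact ⟨a, x, by linear_combination hx⟩
  · obtain ⟨x, hx⟩ := aux_hensel p hp u (v * b ^ 2 + w) a hu ha (by
      simp only [map_add, map_mul, map_pow]; linear_combination hab)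
    exact ⟨x, b, by linear_combination hx⟩

theorem aux_decomp (p : ℕ) [Fact p.Prime] (a : ℚ_[p]) (ha : a ≠ 0) :
    ∃ u : ℤ_[p], ‖u‖ = 1 ∧ a = (p : ℚ_[p]) ^ a.valuation * u := by
  have hp0 : (p : ℚ_[p]) ≠ 0 := by exact_mod_cast (Fact.out : p.Prime).ne_zero
  have hp1 : (p : ℝ) ≠ 0 := by exact_mod_cast (Fact.out : p.Prime).ne_zero
  have hn : ‖(p : ℚ_[p]) ^ (-a.valuation) * a‖ = 1 := by
    rw [norm_mul, Padic.norm_p_zpow, Padic.norm_eq_zpow_neg_valuation ha, ← zpow_add₀ hp1]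
    simp
  refine ⟨⟨_, hn.le⟩, hn, ?_⟩
  change a = (p : ℚ_[p]) ^ a.valuation * ((p : ℚ_[p]) ^ (-a.valuation) * a)
  rw [← mul_assoc, ← zpow_add₀ hp0]
  simp

theorem aux_ternary (p : ℕ) [Fact p.Prime] (hp : p ≠ 2) (a b c : ℚ_[p]) (ha : a ≠ 0) (hb : b ≠ 0)
    (hc : c ≠ 0) (hab : a.valuation % 2 = c.valuation % 2) (hbc : b.valuation % 2 = c.valuation % 2) :
    ∃ x y z : ℚ_[p], z ≠ 0 ∧ a * x ^ 2 + b * y ^ 2 + c * z ^ 2 = 0 := by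
  have hp0 : (p : ℚ_[p]) ≠ 0 := by exact_mod_cast (Fact.out : p.Prime).ne_zero
  obtain ⟨u, hu, hau⟩ := aux_decomp p a ha
  obtain ⟨v, hv, hbv⟩ := aux_decomp p b hb
  obtain ⟨w, hw, hcw⟩ := aux_decomp p c hc
  obtain ⟨x, y, h⟩ := aux_units p hp u v w hu hv hw
  have h' : (u : ℚ_[p]) * x ^ 2 + v * y ^ 2 + w = 0 := by exact_mod_cast congrArg (Subtype.val) h
  have scale : ∀ n : ℤ, n % 2 = c.valuation % 2 →
      (p : ℚ_[p]) ^ n * ((p : ℚ_[p]) ^ (-(n / 2))) ^ 2 = (p : ℚ_[p]) ^ (c.valuation % 2) := by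
    intro n hn
    rw [← zpow_natCast, ← zpow_mul, ← zpow_add₀ hp0]
    congr 1
    push_cast
    omega
  refine ⟨(p : ℚ_[p]) ^ (-(a.valuation / 2)) * x, (p : ℚ_[p]) ^ (-(b.valuation / 2)) * y,
    (p : ℚ_[p]) ^ (-(c.valuation / 2)), zpow_ne_zero _ hp0, ?_⟩
  have e1 := scale _ hab
  have e2 := scale _ hbc
  have e3 := scale _ rfl
  generalize (p : ℚ_[p]) ^ (-(a.valuation / 2)) = A at *
  generalize (p : ℚ_[p]) ^ (-(b.valuation / 2)) = B at *
  generalize (p : ℚ_[p]) ^ (-(c.valuation / 2)) = C at *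
  generalize (p : ℚ_[p]) ^ (c.valuation % 2) = D at *
  generalize (p : ℚ_[p]) ^ (a.valuation) = A' at *
  generalize (p : ℚ_[p]) ^ (b.valuation) = B' at *
  generalize (p : ℚ_[p]) ^ (c.valuation) = C' at *
  rw [hau, hbv, hcw]
  linear_combination D * h' + (u : ℚ_[p]) * x ^ 2 * e1 + (v : ℚ_[p]) * y ^ 2 * e2 + (w : ℚ_[p]) * e3

theorem aux_dim (p : ℕ) [Fact p.Prime] (hp : p ≠ 2)
    (U : Type*) [AddCommGroup U] [Module ℚ_[p] U] [FiniteDimensional ℚ_[p] U]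
    (Q : QuadraticForm ℚ_[p] U) (hQ : Q.Anisotropic) : Module.finrank ℚ_[p] U ≤ 4 := by
  by_contra! hlt
  have : Invertible (2 : ℚ_[p]) := invertibleOfNonzero two_ne_zero
  obtain ⟨w, ⟨e⟩⟩ := QuadraticForm.equivalent_weightedSumSquares Q
  generalize Module.finrank ℚ_[p] U = n at *
  have han : ∀ x : Fin n → ℚ_[p], ∑ i, w i * (x i * x i) = 0 → x = 0 := by
    intro x hx
    have h1 : Q (e.symm x) = 0 := by
      rw [← e.map_app, e.apply_symm_apply, QuadraticMap.weightedSumSquares_apply]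
      simpa using hx
    have h2 := hQ _ h1
    rw [← e.apply_symm_apply x, h2]
    exact map_zero e.toLinearEquiv
  have hw : ∀ i, w i ≠ 0 := by
    intro i hi
    have h := han (Pi.single i 1) (by
      apply Finset.sum_eq_zero
      intro j _
      by_cases hj : j = i
      · subst hj; simp [hi]
      · simp [hj])
    have := congrFun h i
    simp at this
  obtain ⟨y, -, hy⟩ := Finset.exists_lt_card_fiber_of_mul_lt_card_of_maps_to (s := (Finset.univ : Finset (Fin n)))
    (t := ({0, 1} : Finset ℤ)) (f := fun i => (w i).valuation % 2) (n := 2)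
    (by intro i _; simp; omega) (by simp; omega)
  obtain ⟨i, j, k, hi, hj, hk, hij, hik, hjk⟩ := Finset.two_lt_card_iff.1 hy
  simp at hi hj hk
  obtain ⟨a, b, c, hc, h⟩ := aux_ternary p hp (w i) (w j) (w k) (hw i) (hw j) (hw k)
    (by rw [hi, hk]) (by rw [hj, hk])
  have h0 := han (fun l => if l = i then a else if l = j then b else if l = k then c else 0) (by
    rw [← Finset.sum_subset (Finset.subset_univ {i, j, k})]
    · rw [Finset.sum_insert (by simp [hij, hik]), Finset.sum_insert (by simp [hjk]), Finset.sum_singleton]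
      simp [hij.symm, hik.symm, hjk.symm]
      linear_combination h
    · intro l _ hl
      simp at hl
      simp [hl])
  have := congrFun h0 k
  simp [hik.symm, hjk.symm] at this
  exact hc this

open QuadraticMap in
theorem aux_witt.{u, v} {K : Type v} [Field K] (n : ℕ) : ∀ (U : Type u) [AddCommGroup U] [Module K U]
    [FiniteDimensional K U] (Q : QuadraticForm K U) (_ : Module.finrank K U = n)
    (_ : ∀ x, (∀ y, polar Q x y = 0) → x = 0),
    ∃ (d : ℕ) (W : Submodule K U), (Q.comp W.subtype).Anisotropic ∧
      QuadraticMap.Equivalent Q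
        ((QuadraticMap.pi fun _ : Fin d => hyperbolicPlane K).prod (Q.comp W.subtype)) := by
  induction n using Nat.strong_induction_on with
  | _ n ih =>
  intro U _ _ _ Q hn hQ
  by_cases han : Q.Anisotropic
  · refine ⟨0, ⊤, ?_, ⟨?_⟩⟩
    · intro x hx
      exact Subtype.ext (han _ hx)
    · refine ⟨(Submodule.topEquiv.symm.trans (LinearEquiv.uniqueProd (R := K) (M := (⊤ : Submodule K U)) (M₂ := Fin 0 → K × K)).symm), ?_⟩
      intro m
      simp [LinearEquiv.uniqueProd, QuadraticMap.prod_apply]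
  rw [not_anisotropic_iff_exists] at han
  obtain ⟨v, hv, hQv⟩ := han
  obtain ⟨w₀, hw₀⟩ : ∃ y, polar Q v y ≠ 0 := by
    by_contra! h
    exact hv (hQ v h)
  obtain ⟨w, hvw, hQw⟩ : ∃ w, polar Q v w = 1 ∧ Q w = 0 := by
    obtain ⟨w₁, hw₁⟩ : ∃ w, polar Q v w = 1 :=
      ⟨(polar Q v w₀)⁻¹ • w₀, by rw [polar_smul_right, smul_eq_mul, inv_mul_cancel₀ hw₀]⟩
    have hvv : polar Q v v = 0 := by rw [polar_self, hQv, smul_zero]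
    refine ⟨w₁ + (-Q w₁) • v, ?_, ?_⟩
    · rw [polar_add_right, polar_smul_right, hvv, hw₁]; simp
    · rw [QuadraticMap.map_add Q, QuadraticMap.map_smul, polar_smul_right, polar_comm, hw₁, hQv]; simp
  have hwv : polar Q w v = 1 := by rw [polar_comm, hvw]
  have hvv : polar Q v v = 0 := by rw [polar_self, hQv, smul_zero]
  have hww : polar Q w w = 0 := by rw [polar_self, hQw, smul_zero]
  let V : Submodule K U := LinearMap.ker (Q.polarBilin v) ⊓ LinearMap.ker (Q.polarBilin w)
  have hV : ∀ x, x ∈ V ↔ polar Q v x = 0 ∧ polar Q w x = 0 := by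
    intro x; simp [V]
  let g : ((K × K) × V) →ₗ[K] U :=
    ((LinearMap.toSpanSingleton K U v).coprod (LinearMap.toSpanSingleton K U w)).coprod V.subtype
  have hg : ∀ a b (x : V), g ((a, b), x) = a • v + b • w + x := by
    intro a b x; simp [g]
  have hgv : ∀ a b (x : V), polar Q v (g ((a, b), x)) = b := by
    intro a b x
    rw [hg, polar_add_right, polar_add_right, polar_smul_right, polar_smul_right, hvv, hvw,
      ((hV x).1 x.2).1]; simp
  have hgw : ∀ a b (x : V), polar Q w (g ((a, b), x)) = a := by
    intro a b x
    rw [hg, polar_add_right, polar_add_right, polar_smul_right, polar_smul_right, hwv, hww,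
      ((hV x).1 x.2).2]; simp
  have ginj : Function.Injective g := by
    rw [← LinearMap.ker_eq_bot, LinearMap.ker_eq_bot']
    rintro ⟨⟨a, b⟩, x⟩ h
    have hb := hgv a b x
    have ha := hgw a b x
    rw [h, polar_zero_right] at ha hb
    subst ha hb
    rw [hg] at h
    simpa using h
  have gsurj : Function.Surjective g := by
    intro x
    refine ⟨((polar Q w x, polar Q v x), ⟨x - polar Q w x • v - polar Q v x • w, ?_⟩), ?_⟩
    · rw [hV]
      simp only [polar_sub_right, polar_smul_right, hvv, hvw, hwv, hww, smul_eq_mul]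
      constructor <;> ring
    · rw [hg]
      simp only
      abel
  have hQg : ∀ a b (x : V), Q (g ((a, b), x)) = a * b + Q x := by
    intro a b x
    rw [hg, QuadraticMap.map_add Q, QuadraticMap.map_add Q, QuadraticMap.map_smul,
      QuadraticMap.map_smul, hQv, hQw, polar_add_left, polar_smul_left, polar_smul_left,
      polar_smul_left, polar_smul_right, hvw, ((hV x).1 x.2).1, ((hV x).1 x.2).2]
    simp
  let G : ((K × K) × V) ≃ₗ[K] U := LinearEquiv.ofBijective g ⟨ginj, gsurj⟩
  have hdim : Module.finrank K V < n := by
    have := G.finrank_eq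
    rw [Module.finrank_prod, Module.finrank_prod, Module.finrank_self] at this
    omega
  obtain ⟨d, W, hW, ⟨E⟩⟩ := ih _ hdim V (Q.comp V.subtype) rfl (by
    intro x hx
    apply Subtype.ext
    apply hQ
    intro y
    obtain ⟨⟨⟨a, b⟩, z⟩, rfl⟩ := gsurj y
    have h1 : polar Q (x : U) z = 0 := hx z
    rw [hg, polar_add_right, polar_add_right, polar_smul_right, polar_smul_right, h1,
      polar_comm Q _ v, polar_comm Q _ w, ((hV x).1 x.2).1, ((hV x).1 x.2).2]
    simp)
  let S : W ≃ₗ[K] W.map V.subtype := W.equivMapOfInjective V.subtype V.injective_subtype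
  have hS : ∀ x, (S x : U) = x := fun x => rfl
  refine ⟨d + 1, W.map V.subtype, ?_, ?_⟩
  · intro x hx
    obtain ⟨x, rfl⟩ := S.surjective x
    have : x = 0 := hW x hx
    rw [this, map_zero]
  · let T : U ≃ₗ[K] ((Fin (d + 1) → K × K) × (W.map V.subtype)) :=
      G.symm.trans (((LinearEquiv.refl K (K × K)).prodCongr E.toLinearEquiv).trans
        ((LinearEquiv.prodAssoc K (K × K) (Fin d → K × K) W).symm.trans
          ((Fin.consLinearEquiv K (fun _ : Fin (d + 1) => K × K)).prodCongr S)))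
    refine ⟨⟨T, ?_⟩⟩
    intro m
    obtain ⟨⟨⟨a, b⟩, x⟩, rfl⟩ := G.surjective m
    have hE := E.map_app x
    have h1 : Q (G ((a, b), x)) = a * b + Q x := hQg a b x
    have h2 : T (G ((a, b), x)) = (Fin.cons (a, b) (E x).1, S (E x).2) := by
      simp [T]
      exact ⟨rfl, rfl⟩
    change QuadraticMap.prod _ _ (T _) = _
    rw [h1, h2]
    simp only [QuadraticMap.prod_apply, QuadraticMap.pi_apply, Fin.sum_univ_succ, Fin.cons_zero,
      Fin.cons_succ, QuadraticMap.comp_apply, Submodule.subtype_apply, hS] at hE ⊢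
    rw [← hE, ← add_assoc]
    rfl

/-- Every nondegenerate quadratic space over `ℚ_p` (p odd) decomposes as an
orthogonal direct sum of `d` hyperbolic planes and an anisotropic subspace, whose
dimension is at most `4`. -/
theorem stmt_1 (p : ℕ) [Fact p.Prime] (hp : p ≠ 2)
    (U : Type*) [AddCommGroup U] [Module ℚ_[p] U] [FiniteDimensional ℚ_[p] U]
    (Q : QuadraticForm ℚ_[p] U)
    (hQ : (QuadraticMap.polarBilin Q).Nondegenerate) :
    ∃ (d : ℕ) (W : Submodule ℚ_[p] U),
      (Q.comp W.subtype).Anisotropic ∧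
      QuadraticMap.Equivalent Q
        ((QuadraticMap.pi fun _ : Fin d => hyperbolicPlane ℚ_[p]).prod (Q.comp W.subtype)) ∧
      Module.finrank ℚ_[p] W ≤ 4 := by
  obtain ⟨d, W, hW, hE⟩ := aux_witt _ U Q rfl (fun x hx => hQ.1 x hx)
  exact ⟨d, W, hW, hE, aux_dim p hp W _ hW⟩
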